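/- arXiv:2605.01442 — 2 statements merged into one kernel-verified Lean document; each statement's English description precedes it below -/
import Mathlib

section
/- (Theorem 3) Let K be an EL knowledge base, C an EL concept, and x, y individual names with K ⊨ C(x) and K ⊭ C(y). Let J be a justification for C(x) in K such that y occurs in no axiom of J, and set J' := J[x↦y], J_t := J' ∩ K, and H := J' \ K. Then J' is a foil-justification for C(y) (J' ⊨ C(y), no proper subset of J' entails C(y), and K ∪ H is consistent), and the associated contrastive explanation E_J = ⟨J ∸_{x↦y} J_t, J_t ∸_{y↦x} J, H⟩ has divergence σ^div(E_J) = 0. -/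
/-- EL concepts over concept names `NC` and role names `NR`. -/
inductive ELConcept (NC NR : Type) : Type
  | atom  : NC → ELConcept NC NR
  | top   : ELConcept NC NR
  | inter : ELConcept NC NR → ELConcept NC NR → ELConcept NC NR
  | ex    : NR → ELConcept NC NR → ELConcept NC NR

/-- EL axioms: GCIs, concept assertions, role assertions. -/
inductive ELAxiom (NC NR NI : Type) : Type
  | gci  : ELConcept NC NR → ELConcept NC NR → ELAxiom NC NR NI
  | inst : ELConcept NC NR → NI → ELAxiom NC NR NI
  | role : NR → NI → NI → ELAxiom NC NR NI

/-- A DL interpretation. -/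
structure DLInterp (NC NR NI : Type) : Type 1 where
  Dom : Type
  dom_nonempty : Nonempty Dom
  cI : NC → Set Dom
  rI : NR → Set (Dom × Dom)
  iI : NI → Dom

/-- Semantics of EL concepts. -/
def ELConcept.interp {NC NR NI : Type} (I : DLInterp NC NR NI) :
    ELConcept NC NR → Set I.Dom
  | .atom A => I.cI A
  | .top => Set.univ
  | .inter C D => C.interp I ∩ D.interp I
  | .ex r C => {d | ∃ e, (d, e) ∈ I.rI r ∧ e ∈ C.interp I}

/-- Satisfaction of an EL axiom in an interpretation. -/
def ELAxiom.sat {NC NR NI : Type} (I : DLInterp NC NR NI) :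
    ELAxiom NC NR NI → Prop
  | .gci C D => C.interp I ⊆ D.interp I
  | .inst C a => I.iI a ∈ C.interp I
  | .role r a b => (I.iI a, I.iI b) ∈ I.rI r

/-- `I` is a model of the set `S` of axioms. -/
def ELModels {NC NR NI : Type} (I : DLInterp NC NR NI) (S : Set (ELAxiom NC NR NI)) : Prop :=
  ∀ α ∈ S, α.sat I

/-- `S ⊨ α`. -/
def ELEntails {NC NR NI : Type} (S : Set (ELAxiom NC NR NI)) (α : ELAxiom NC NR NI) : Prop :=
  ∀ I : DLInterp NC NR NI, ELModels I S → α.sat I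

/-- `S` is consistent. -/
def ELConsistent {NC NR NI : Type} (S : Set (ELAxiom NC NR NI)) : Prop :=
  ∃ I : DLInterp NC NR NI, ELModels I S

/-- ABox assertions. -/
def ELAxiom.isAssertion {NC NR NI : Type} : ELAxiom NC NR NI → Prop
  | .gci _ _ => False
  | .inst _ _ => True
  | .role _ _ _ => True

/-- GCIs. -/
def ELAxiom.isGCI {NC NR NI : Type} : ELAxiom NC NR NI → Prop
  | .gci _ _ => True
  | .inst _ _ => False
  | .role _ _ _ => False

/-- `J` is a justification for `α` in `K`. -/
def ELJustification {NC NR NI : Type} (K : Set (ELAxiom NC NR NI))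
    (α : ELAxiom NC NR NI) (J : Set (ELAxiom NC NR NI)) : Prop :=
  J ⊆ K ∧ ELEntails J α ∧ ∀ J' ⊂ J, ¬ ELEntails J' α

/-- Rename an individual name: replace `x` by `y`. -/
def renameInd {NI : Type} [DecidableEq NI] (x y a : NI) : NI := if a = x then y else a

/-- `β[x↦y]`: replace every occurrence of the individual name `x` by `y`
(GCIs contain no individual names and are unchanged). -/
def ELAxiom.rename {NC NR NI : Type} [DecidableEq NI] (x y : NI) :
    ELAxiom NC NR NI → ELAxiom NC NR NI
  | .gci C D => .gci C D
  | .inst C a => .inst C (renameInd x y a)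
  | .role r a b => .role r (renameInd x y a) (renameInd x y b)

/-- The individual name `z` occurs in an EL axiom. -/
def ELAxiom.indOccurs {NC NR NI : Type} (z : NI) : ELAxiom NC NR NI → Prop
  | .gci _ _ => False
  | .inst _ a => a = z
  | .role _ a b => a = z ∨ b = z

/-- The set difference between `J1` and `J2` relative to the renaming `γ ↦ δ`:
`J1 ∸_{γ↦δ} J2 = {α ∈ J1 | α ∉ J2 and α[γ↦δ] ∉ J2}`. -/
def ELRelDiff {NC NR NI : Type} [DecidableEq NI] (γ δ : NI)
    (J1 J2 : Set (ELAxiom NC NR NI)) : Set (ELAxiom NC NR NI) :=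
  {α ∈ J1 | α ∉ J2 ∧ ELAxiom.rename γ δ α ∉ J2}

/-- The interpretation `I` with the individual name `a` reinterpreted as `d`. -/
def DLInterp.updateInd {NC NR NI : Type} [DecidableEq NI] (I : DLInterp NC NR NI)
    (a : NI) (d : I.Dom) : DLInterp NC NR NI where
  Dom := I.Dom
  dom_nonempty := I.dom_nonempty
  cI := I.cI
  rI := I.rI
  iI := Function.update I.iI a d

theorem ELConcept.interp_updateInd {NC NR NI : Type} [DecidableEq NI] (I : DLInterp NC NR NI)
    (a : NI) (d : I.Dom) (C : ELConcept NC NR) :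
    C.interp (I.updateInd a d) = C.interp I := by
  induction C with
  | atom A => rfl
  | top => rfl
  | inter C D hC hD => simp only [ELConcept.interp, hC, hD]; rfl
  | ex r C hC => simp only [ELConcept.interp, hC]; rfl

theorem ELAxiom.sat_inst_updateInd_self {NC NR NI : Type} [DecidableEq NI]
    (I : DLInterp NC NR NI) (C : ELConcept NC NR) (a b : NI) :
    (ELAxiom.inst C a).sat (I.updateInd a (I.iI b)) ↔ (ELAxiom.inst C b).sat I := by
  simp only [ELAxiom.sat, ELConcept.interp_updateInd]
  simp [DLInterp.updateInd]
  rfl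

/-- Substitution lemma: renaming `x` to `y` amounts to reinterpreting `x` as `y`. -/
theorem ELAxiom.sat_updateInd_iff_sat_rename {NC NR NI : Type} [DecidableEq NI]
    (I : DLInterp NC NR NI) (x y : NI) (β : ELAxiom NC NR NI) :
    β.sat (I.updateInd x (I.iI y)) ↔ (β.rename x y).sat I := by
  have key (a : NI) : (I.updateInd x (I.iI y)).iI a = I.iI (renameInd x y a) := by
    by_cases h : a = x <;> simp [DLInterp.updateInd, renameInd, h]
  cases β <;> simp only [ELAxiom.sat, ELAxiom.rename, ELConcept.interp_updateInd, key] <;> rfl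

theorem renameInd_renameInd_cancel {NI : Type} [DecidableEq NI] {x y a : NI} (h : a ≠ y) :
    renameInd y x (renameInd x y a) = a := by
  grind [renameInd]

theorem renameInd_idem {NI : Type} [DecidableEq NI] (x y a : NI) :
    renameInd x y (renameInd x y a) = renameInd x y a := by
  grind [renameInd]

theorem ELAxiom.rename_rename_cancel {NC NR NI : Type} [DecidableEq NI] {x y : NI}
    {β : ELAxiom NC NR NI} (h : ¬ β.indOccurs y) : (β.rename x y).rename y x = β := by
  cases β <;> simp_all [ELAxiom.indOccurs, ELAxiom.rename, renameInd_renameInd_cancel]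

theorem ELAxiom.rename_idem {NC NR NI : Type} [DecidableEq NI] (x y : NI)
    (β : ELAxiom NC NR NI) : (β.rename x y).rename x y = β.rename x y := by
  cases β <;> simp [ELAxiom.rename, renameInd_idem]

/-- Entailment of a concept assertion is preserved by renaming its individual. -/
theorem ELEntails.rename_inst {NC NR NI : Type} [DecidableEq NI] {J : Set (ELAxiom NC NR NI)}
    {C : ELConcept NC NR} {x : NI} (h : ELEntails J (.inst C x)) (y : NI) :
    ELEntails (ELAxiom.rename x y '' J) (.inst C y) := by
  intro I hI
  refine (ELAxiom.sat_inst_updateInd_self I C x y).1 (h _ fun β hβ => ?_)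
  exact (ELAxiom.sat_updateInd_iff_sat_rename I x y β).2 (hI _ ⟨β, hβ, rfl⟩)

/-- Every set of EL axioms is consistent: a one-point interpretation with full concepts and roles
is a model. -/
theorem ELConsistent.of_el {NC NR NI : Type} (S : Set (ELAxiom NC NR NI)) : ELConsistent S := by
  let I : DLInterp NC NR NI :=
    ⟨Unit, inferInstance, fun _ => Set.univ, fun _ => Set.univ, fun _ => ()⟩
  have key (C : ELConcept NC NR) (d : Unit) : d ∈ C.interp I := by
    induction C with
    | atom A => trivial
    | top => trivial
    | inter C D hC hD => exact ⟨hC, hD⟩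
    | ex r C hC => exact ⟨d, trivial, hC⟩
  refine ⟨I, fun α _ => ?_⟩
  cases α with
  | gci C D => exact fun d _ => key D d
  | inst C a => exact key C _
  | role r a b => trivial

/-- Theorem 3: let `K ⊨ C(x)`, `K ⊭ C(y)`, let `J` be a justification for
`C(x)` in `K` with `y` occurring in no axiom of `J`, and set `J' = J[x↦y]`, `J_t = J' ∩ K`,
`H = J' \ K`. Then `J'` is a foil-justification for `C(y)` (`J' ⊨ C(y)`, no proper subset of
`J'` entails `C(y)`, and `K ∪ H` is consistent), and the associated contrastive explanation
`E_J = ⟨J ∸_{x↦y} J_t, J_t ∸_{y↦x} J, H⟩` has divergence `σ^div(E_J) = 0`. -/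
theorem rename_justification_zero_divergence {NC NR NI : Type} [DecidableEq NI]
    (K : Finset (ELAxiom NC NR NI)) (C : ELConcept NC NR) (x y : NI)
    (hP : ELEntails (K : Set (ELAxiom NC NR NI)) (ELAxiom.inst C x))
    (hQ : ¬ ELEntails (K : Set (ELAxiom NC NR NI)) (ELAxiom.inst C y))
    (J : Set (ELAxiom NC NR NI))
    (hJ : ELJustification (K : Set (ELAxiom NC NR NI)) (ELAxiom.inst C x) J)
    (hfresh : ∀ β ∈ J, ¬ ELAxiom.indOccurs y β)
    (J' Jt H Efact Efoil : Set (ELAxiom NC NR NI))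
    (hJ' : J' = ELAxiom.rename x y '' J)
    (hJt : Jt = J' ∩ (K : Set (ELAxiom NC NR NI)))
    (hH : H = J' \ (K : Set (ELAxiom NC NR NI)))
    (hEfact : Efact = ELRelDiff x y J Jt)
    (hEfoil : Efoil = ELRelDiff y x Jt J ∪ H) :
    (ELEntails J' (ELAxiom.inst C y) ∧
      (∀ S ⊂ J', ¬ ELEntails S (ELAxiom.inst C y)) ∧
      ELConsistent ((K : Set (ELAxiom NC NR NI)) ∪ H)) ∧
    (ELRelDiff x y Efact Efoil).ncard + (ELRelDiff y x Efoil Efact).ncard = 0 := by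
  have cancel {β : ELAxiom NC NR NI} (hβ : β ∈ J) : (β.rename x y).rename y x = β :=
    ELAxiom.rename_rename_cancel (hfresh β hβ)
  obtain ⟨-, hent, hmin⟩ := hJ
  subst hJ'
  refine ⟨⟨hent.rename_inst y, fun S hS hSC => ?_, ELConsistent.of_el _⟩, ?_⟩
  · obtain ⟨s, ⟨β, hβ, rfl⟩, hβS⟩ := Set.exists_of_ssubset hS
    refine hmin (ELAxiom.rename y x '' S) ⟨?_, fun hsub => ?_⟩ (hSC.rename_inst x)
    · rintro _ ⟨s, hs, rfl⟩
      obtain ⟨γ, hγ, rfl⟩ := hS.1 hs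
      rwa [cancel hγ]
    · obtain ⟨s, hs, hsβ⟩ := hsub hβ
      obtain ⟨γ, hγ, rfl⟩ := hS.1 hs
      rw [cancel hγ] at hsβ
      exact hβS (hsβ ▸ hs)
  · have hfact : ELRelDiff x y Efact Efoil = ∅ := by
      refine Set.eq_empty_iff_forall_notMem.2 ?_
      rintro α ⟨hα, -, hαfoil⟩
      rw [hEfact] at hα
      obtain ⟨hαJ, -, hαt⟩ := hα
      rw [hJt] at hαt
      refine hαfoil ?_
      rw [hEfoil, hH]
      exact Or.inr ⟨⟨α, hαJ, rfl⟩, fun hK => hαt ⟨⟨α, hαJ, rfl⟩, hK⟩⟩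
    have hfoil : ELRelDiff y x Efoil Efact = ∅ := by
      refine Set.eq_empty_iff_forall_notMem.2 ?_
      rintro α ⟨hα, -, hαfact⟩
      rw [hEfoil, hH, hJt] at hα
      rcases hα with ⟨⟨⟨β, hβ, rfl⟩, -⟩, -, hβJ⟩ | ⟨⟨β, hβ, rfl⟩, hβK⟩
      · exact hβJ ((cancel hβ).symm ▸ hβ)
      · rw [cancel hβ, hEfact, hJt] at hαfact
        refine hαfact ⟨hβ, ?_, fun h => hβK h.2⟩
        rintro ⟨⟨γ, -, rfl⟩, hγK⟩
        exact hβK ((ELAxiom.rename_idem x y γ).symm ▸ hγK)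
    simp [hfact, hfoil]
end

section
/- (Theorem 2, first part) For n ≥ 1, let T_n := {A_{i-1} ⊑ X_i ⊓ Y_i, X_i ⊑ A_i, Y_i ⊑ A_i : 1 ≤ i ≤ n} be the EL TBox over pairwise distinct concept names A_0, …, A_n, X_1, …, X_n, Y_1, …, Y_n, and let K_n := T_n ∪ {A_0(x)} for an individual name x. Then every justification for A_n(x) in K_n contains A_0(x), contains the axiom A_{i-1} ⊑ X_i ⊓ Y_i for every 1 ≤ i ≤ n, and contains exactly one of the axioms X_i ⊑ A_i, Y_i ⊑ A_i for every 1 ≤ i ≤ n. Consequently, the justifications for A_n(x) in K_n are exactly the 2^n sets J_f := {A_0(x)} ∪ {A_{i-1} ⊑ X_i ⊓ Y_i : 1 ≤ i ≤ n} ∪ {f(i)_i ⊑ A_i : 1 ≤ i ≤ n} for f : {1, …, n} → {X, Y}; each has cardinality 2n + 1, so A_n(x) has exactly 2^n cardinality-minimal justifications in K_n. -/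
/-- The GCI `A_{i-1} ⊑ X_i ⊓ Y_i` (indices: `nm ∘ Sum.inl` lists `A_0, …, A_n`,
`nm ∘ Sum.inr ∘ Sum.inl` lists `X_1, …, X_n`, `nm ∘ Sum.inr ∘ Sum.inr` lists `Y_1, …, Y_n`). -/
def axGA (NC NR NI : Type) (n : ℕ) (nm : Fin (n + 1) ⊕ (Fin n ⊕ Fin n) → NC) (i : Fin n) :
    ELAxiom NC NR NI :=
  ELAxiom.gci (ELConcept.atom (nm (Sum.inl i.castSucc)))
    (ELConcept.inter (ELConcept.atom (nm (Sum.inr (Sum.inl i))))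
      (ELConcept.atom (nm (Sum.inr (Sum.inr i)))))

/-- The GCI `X_i ⊑ A_i`. -/
def axGX (NC NR NI : Type) (n : ℕ) (nm : Fin (n + 1) ⊕ (Fin n ⊕ Fin n) → NC) (i : Fin n) :
    ELAxiom NC NR NI :=
  ELAxiom.gci (ELConcept.atom (nm (Sum.inr (Sum.inl i))))
    (ELConcept.atom (nm (Sum.inl i.succ)))

/-- The GCI `Y_i ⊑ A_i`. -/
def axGY (NC NR NI : Type) (n : ℕ) (nm : Fin (n + 1) ⊕ (Fin n ⊕ Fin n) → NC) (i : Fin n) :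
    ELAxiom NC NR NI :=
  ELAxiom.gci (ELConcept.atom (nm (Sum.inr (Sum.inr i))))
    (ELConcept.atom (nm (Sum.inl i.succ)))

/-- The TBox `T_n = {A_{i-1} ⊑ X_i ⊓ Y_i, X_i ⊑ A_i, Y_i ⊑ A_i : 1 ≤ i ≤ n}`. -/
def TBn (NC NR NI : Type) (n : ℕ) (nm : Fin (n + 1) ⊕ (Fin n ⊕ Fin n) → NC) :
    Set (ELAxiom NC NR NI) :=
  Set.range (axGA NC NR NI n nm) ∪ Set.range (axGX NC NR NI n nm) ∪
    Set.range (axGY NC NR NI n nm)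

/-- The KB `K_n = T_n ∪ {A_0(x)}`. -/
def KBn (NC NR NI : Type) (n : ℕ) (nm : Fin (n + 1) ⊕ (Fin n ⊕ Fin n) → NC) (x : NI) :
    Set (ELAxiom NC NR NI) :=
  TBn NC NR NI n nm ∪ {ELAxiom.inst (ELConcept.atom (nm (Sum.inl 0))) x}

/-- The set `J_f = {A_0(x)} ∪ {A_{i-1} ⊑ X_i ⊓ Y_i : i} ∪ {f(i)_i ⊑ A_i : i}`,
where `f i = true` selects `X_i ⊑ A_i` and `f i = false` selects `Y_i ⊑ A_i`. -/
def Jfam (NC NR NI : Type) (n : ℕ) (nm : Fin (n + 1) ⊕ (Fin n ⊕ Fin n) → NC) (x : NI)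
    (f : Fin n → Bool) : Set (ELAxiom NC NR NI) :=
  {ELAxiom.inst (ELConcept.atom (nm (Sum.inl 0))) x} ∪
    Set.range (axGA NC NR NI n nm) ∪
    Set.range (fun i => if f i then axGX NC NR NI n nm i else axGY NC NR NI n nm i)

/-- The interpretation over a one-element domain in which exactly the concept names in `S` hold. -/
def DLInterp.ofNames {NC : Type} (NR NI : Type) (S : Set NC) : DLInterp NC NR NI where
  Dom := Unit
  dom_nonempty := ⟨()⟩
  cI A := {_d | A ∈ S}
  rI _ := ∅
  iI _ := ()

section OneElement

variable {NC : Type} (NR NI : Type) {n : ℕ} {nm : Fin (n + 1) ⊕ (Fin n ⊕ Fin n) → NC}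

lemma sat_ofNames_inst (hnm : Function.Injective nm)
    (p : Set (Fin (n + 1) ⊕ (Fin n ⊕ Fin n))) (j) (x : NI) :
    (ELAxiom.inst (ELConcept.atom (nm j)) x).sat (DLInterp.ofNames NR NI (nm '' p)) ↔ j ∈ p :=
  hnm.mem_set_image

lemma sat_ofNames_axGA (hnm : Function.Injective nm)
    (p : Set (Fin (n + 1) ⊕ (Fin n ⊕ Fin n))) (i : Fin n) :
    (axGA NC NR NI n nm i).sat (DLInterp.ofNames NR NI (nm '' p)) ↔
      (Sum.inl i.castSucc ∈ p → Sum.inr (Sum.inl i) ∈ p ∧ Sum.inr (Sum.inr i) ∈ p) := by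
  rw [← hnm.mem_set_image, ← hnm.mem_set_image (s := p), ← hnm.mem_set_image (s := p)]
  exact ⟨fun h ha => @h () ha, fun h _ ha => h ha⟩

lemma sat_ofNames_axGX (hnm : Function.Injective nm)
    (p : Set (Fin (n + 1) ⊕ (Fin n ⊕ Fin n))) (i : Fin n) :
    (axGX NC NR NI n nm i).sat (DLInterp.ofNames NR NI (nm '' p)) ↔
      (Sum.inr (Sum.inl i) ∈ p → Sum.inl i.succ ∈ p) := by
  rw [← hnm.mem_set_image, ← hnm.mem_set_image (s := p)]
  exact ⟨fun h ha => @h () ha, fun h _ ha => h ha⟩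

lemma sat_ofNames_axGY (hnm : Function.Injective nm)
    (p : Set (Fin (n + 1) ⊕ (Fin n ⊕ Fin n))) (i : Fin n) :
    (axGY NC NR NI n nm i).sat (DLInterp.ofNames NR NI (nm '' p)) ↔
      (Sum.inr (Sum.inr i) ∈ p → Sum.inl i.succ ∈ p) := by
  rw [← hnm.mem_set_image, ← hnm.mem_set_image (s := p)]
  exact ⟨fun h ha => @h () ha, fun h _ ha => h ha⟩

end OneElement

section Family

variable {NC NR NI : Type} {n : ℕ} {nm : Fin (n + 1) ⊕ (Fin n ⊕ Fin n) → NC} {x : NI}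

lemma mem_of_entails_of_ofNames (hnm : Function.Injective nm) {J : Set (ELAxiom NC NR NI)}
    (hJK : J ⊆ KBn NC NR NI n nm x)
    (hJ : ELEntails J (ELAxiom.inst (ELConcept.atom (nm (Sum.inl (Fin.last n)))) x))
    (p : Set (Fin (n + 1) ⊕ (Fin n ⊕ Fin n))) (hp : Sum.inl (Fin.last n) ∉ p) :
    (ELAxiom.inst (ELConcept.atom (nm (Sum.inl 0))) x ∈ J ∧ Sum.inl 0 ∉ p) ∨
    (∃ i, axGA NC NR NI n nm i ∈ J ∧ Sum.inl i.castSucc ∈ p ∧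
      ¬ (Sum.inr (Sum.inl i) ∈ p ∧ Sum.inr (Sum.inr i) ∈ p)) ∨
    (∃ i, axGX NC NR NI n nm i ∈ J ∧ Sum.inr (Sum.inl i) ∈ p ∧ Sum.inl i.succ ∉ p) ∨
    (∃ i, axGY NC NR NI n nm i ∈ J ∧ Sum.inr (Sum.inr i) ∈ p ∧ Sum.inl i.succ ∉ p) := by
  by_contra! h
  obtain ⟨h0, hA, hX, hY⟩ := h
  refine hp ((sat_ofNames_inst NR NI hnm p _ x).1 (hJ _ fun α hα => ?_))
  obtain ((⟨i, rfl⟩ | ⟨i, rfl⟩) | ⟨i, rfl⟩) | rfl := hJK hα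
  · exact (sat_ofNames_axGA NR NI hnm p i).2 fun h => hA i hα h
  · exact (sat_ofNames_axGX NR NI hnm p i).2 fun h => hX i hα h
  · exact (sat_ofNames_axGY NR NI hnm p i).2 fun h => hY i hα h
  · exact (sat_ofNames_inst NR NI hnm p _ x).2 (h0 hα)

lemma assertion_mem_of_entails (hnm : Function.Injective nm) {J : Set (ELAxiom NC NR NI)}
    (hJK : J ⊆ KBn NC NR NI n nm x)
    (hJ : ELEntails J (ELAxiom.inst (ELConcept.atom (nm (Sum.inl (Fin.last n)))) x)) :
    ELAxiom.inst (ELConcept.atom (nm (Sum.inl 0))) x ∈ J := by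
  simpa using mem_of_entails_of_ofNames hnm hJK hJ ∅ (by simp)

lemma axGA_mem_of_entails (hnm : Function.Injective nm) {J : Set (ELAxiom NC NR NI)}
    (hJK : J ⊆ KBn NC NR NI n nm x)
    (hJ : ELEntails J (ELAxiom.inst (ELConcept.atom (nm (Sum.inl (Fin.last n)))) x))
    (i : Fin n) : axGA NC NR NI n nm i ∈ J := by
  have hi := i.isLt
  obtain ⟨-, h⟩ | ⟨j, hj, h⟩ | ⟨j, -, h⟩ | ⟨j, -, h⟩ :=
      mem_of_entails_of_ofNames hnm hJK hJ
    {k | Sum.elim (fun a => a.val ≤ i.val) (Sum.elim (fun a => a < i) (fun a => a < i)) k}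
    (by simp)
  · simp at h
  · obtain rfl : j = i := by
      simp only [Set.mem_ofPred_eq, Sum.elim_inl, Sum.elim_inr, Fin.val_castSucc] at h
      omega
    exact hj
  · simp only [Set.mem_ofPred_eq, Sum.elim_inl, Sum.elim_inr, Fin.val_succ] at h
    omega
  · simp only [Set.mem_ofPred_eq, Sum.elim_inl, Sum.elim_inr, Fin.val_succ] at h
    omega

lemma axGX_or_axGY_mem_of_entails (hnm : Function.Injective nm) {J : Set (ELAxiom NC NR NI)}
    (hJK : J ⊆ KBn NC NR NI n nm x)
    (hJ : ELEntails J (ELAxiom.inst (ELConcept.atom (nm (Sum.inl (Fin.last n)))) x))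
    (i : Fin n) : axGX NC NR NI n nm i ∈ J ∨ axGY NC NR NI n nm i ∈ J := by
  have hi := i.isLt
  obtain ⟨-, h⟩ | ⟨j, -, h⟩ | ⟨j, hj, h⟩ | ⟨j, hj, h⟩ :=
      mem_of_entails_of_ofNames hnm hJK hJ
    {k | Sum.elim (fun a => a.val ≤ i.val) (Sum.elim (fun a => a ≤ i) (fun a => a ≤ i)) k}
    (by simp)
  · simp at h
  · simp only [Set.mem_ofPred_eq, Sum.elim_inl, Sum.elim_inr, Fin.val_castSucc] at h
    omega
  · obtain rfl : j = i := by
      simp only [Set.mem_ofPred_eq, Sum.elim_inl, Sum.elim_inr, Fin.val_succ] at h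
      omega
    exact Or.inl hj
  · obtain rfl : j = i := by
      simp only [Set.mem_ofPred_eq, Sum.elim_inl, Sum.elim_inr, Fin.val_succ] at h
      omega
    exact Or.inr hj

lemma axGA_mem_Jfam (f : Fin n → Bool) (i : Fin n) :
    axGA NC NR NI n nm i ∈ Jfam NC NR NI n nm x f :=
  Or.inl (Or.inr ⟨i, rfl⟩)

lemma axGX_mem_Jfam (hnm : Function.Injective nm) (f : Fin n → Bool) (i : Fin n) :
    axGX NC NR NI n nm i ∈ Jfam NC NR NI n nm x f ↔ f i = true := by
  refine ⟨?_, fun h => Or.inr ⟨i, if_pos h⟩⟩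
  rintro ((h | ⟨j, h⟩) | ⟨j, h⟩)
  · simp [axGX] at h
  · simp [axGX, axGA] at h
  · by_cases hj : f j = true
    · simp only [hj, if_true, axGX, ELAxiom.gci.injEq, ELConcept.atom.injEq, hnm.eq_iff,
        Sum.inr.injEq, Sum.inl.injEq] at h
      rwa [← h.1]
    · simp [hj, axGX, axGY, hnm.eq_iff] at h

lemma axGY_mem_Jfam (hnm : Function.Injective nm) (f : Fin n → Bool) (i : Fin n) :
    axGY NC NR NI n nm i ∈ Jfam NC NR NI n nm x f ↔ f i = false := by
  refine ⟨?_, fun h => Or.inr ⟨i, if_neg (by simp [h])⟩⟩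
  rintro ((h | ⟨j, h⟩) | ⟨j, h⟩)
  · simp [axGY] at h
  · simp [axGY, axGA] at h
  · by_cases hj : f j = true
    · simp [hj, axGX, axGY, hnm.eq_iff] at h
    · simp only [hj, axGY, ELAxiom.gci.injEq, ELConcept.atom.injEq, hnm.eq_iff,
        Sum.inr.injEq, if_false, Bool.false_eq_true] at h
      rw [← h.1]
      simpa using hj

lemma Jfam_subset_KBn (f : Fin n → Bool) :
    Jfam NC NR NI n nm x f ⊆ KBn NC NR NI n nm x := by
  rintro _ ((rfl | ⟨i, rfl⟩) | ⟨i, rfl⟩)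
  · exact Or.inr rfl
  · exact Or.inl (Or.inl (Or.inl ⟨i, rfl⟩))
  · dsimp only
    split_ifs
    · exact Or.inl (Or.inl (Or.inr ⟨i, rfl⟩))
    · exact Or.inl (Or.inr ⟨i, rfl⟩)

lemma Jfam_entails (f : Fin n → Bool) :
    ELEntails (Jfam NC NR NI n nm x f)
      (ELAxiom.inst (ELConcept.atom (nm (Sum.inl (Fin.last n)))) x) := by
  intro I hI
  suffices h : ∀ k : Fin (n + 1), (ELAxiom.inst (ELConcept.atom (nm (Sum.inl k))) x).sat I from
    h _
  intro k
  induction k using Fin.induction with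
  | zero => exact hI _ (Or.inl (Or.inl rfl))
  | succ i ih =>
    have hXY := hI _ (axGA_mem_Jfam f i) ih
    have hf := hI _ (Or.inr ⟨i, rfl⟩)
    dsimp only at hf
    split_ifs at hf
    · exact hf hXY.1
    · exact hf hXY.2

lemma eq_of_Jfam_subset (hnm : Function.Injective nm) {f g : Fin n → Bool}
    (h : Jfam NC NR NI n nm x f ⊆ Jfam NC NR NI n nm x g) : f = g := by
  funext i
  cases hf : f i
  · exact ((axGY_mem_Jfam hnm g i).1 (h ((axGY_mem_Jfam hnm f i).2 hf))).symm
  · exact ((axGX_mem_Jfam hnm g i).1 (h ((axGX_mem_Jfam hnm f i).2 hf))).symm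

lemma exists_Jfam_subset_of_entails (hnm : Function.Injective nm) {J : Set (ELAxiom NC NR NI)}
    (hJK : J ⊆ KBn NC NR NI n nm x)
    (hJ : ELEntails J (ELAxiom.inst (ELConcept.atom (nm (Sum.inl (Fin.last n)))) x)) :
    ∃ f, Jfam NC NR NI n nm x f ⊆ J := by
  classical
  refine ⟨fun i => decide (axGX NC NR NI n nm i ∈ J), ?_⟩
  rintro _ ((rfl | ⟨i, rfl⟩) | ⟨i, rfl⟩)
  · exact assertion_mem_of_entails hnm hJK hJ
  · exact axGA_mem_of_entails hnm hJK hJ i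
  · by_cases h : axGX NC NR NI n nm i ∈ J
    · simp [h]
    · simpa [h] using (axGX_or_axGY_mem_of_entails hnm hJK hJ i).resolve_left h

lemma ELJustification_iff_mem_range_Jfam (hnm : Function.Injective nm)
    (J : Set (ELAxiom NC NR NI)) :
    ELJustification (KBn NC NR NI n nm x)
        (ELAxiom.inst (ELConcept.atom (nm (Sum.inl (Fin.last n)))) x) J ↔
      J ∈ Set.range (Jfam NC NR NI n nm x) := by
  constructor
  · rintro ⟨hJK, hJ, hmin⟩
    obtain ⟨f, hf⟩ := exists_Jfam_subset_of_entails hnm hJK hJ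
    refine ⟨f, ?_⟩
    by_contra hne
    exact hmin _ (hf.ssubset_of_ne hne) (Jfam_entails f)
  · rintro ⟨f, rfl⟩
    refine ⟨Jfam_subset_KBn f, Jfam_entails f, fun J' hJ' hent => ?_⟩
    obtain ⟨g, hg⟩ := exists_Jfam_subset_of_entails hnm (hJ'.subset.trans (Jfam_subset_KBn f)) hent
    obtain rfl := eq_of_Jfam_subset hnm (hg.trans hJ'.subset)
    exact hJ'.not_subset hg

lemma ncard_Jfam (hnm : Function.Injective nm) (f : Fin n → Bool) :
    (Jfam NC NR NI n nm x f).ncard = 2 * n + 1 := by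
  have hA : Function.Injective (axGA NC NR NI n nm) := fun i j h => by
    simpa [axGA, hnm.eq_iff] using h
  have hXY : Function.Injective
      (fun i => if f i then axGX NC NR NI n nm i else axGY NC NR NI n nm i) := fun i j h => by
    cases hi : f i <;> cases hj : f j <;> simp [hi, hj, axGX, axGY, hnm.eq_iff] at h <;> exact h
  have hdisj : Disjoint
      ({ELAxiom.inst (ELConcept.atom (nm (Sum.inl 0))) x} ∪ Set.range (axGA NC NR NI n nm))
      (Set.range (fun i => if f i then axGX NC NR NI n nm i else axGY NC NR NI n nm i)) := by
    rw [Set.disjoint_left]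
    rintro _ (rfl | ⟨i, rfl⟩) ⟨j, h⟩ <;> cases hj : f j <;> simp [hj, axGA, axGX, axGY] at h
  have hdisj' : Disjoint {ELAxiom.inst (ELConcept.atom (nm (Sum.inl 0))) x}
      (Set.range (axGA NC NR NI n nm)) := by
    simp [axGA]
  rw [Jfam, Set.ncard_union_eq hdisj (Set.toFinite _) (Set.toFinite _),
    Set.ncard_union_eq hdisj' (Set.toFinite _) (Set.toFinite _), Set.ncard_singleton,
    Set.ncard_range_of_injective hA, Set.ncard_range_of_injective hXY, Nat.card_fin]
  omega

end Family

/-- Theorem 2, first part: every justification for `A_n(x)` in `K_n`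
contains `A_0(x)`, contains `A_{i-1} ⊑ X_i ⊓ Y_i` for every `i`, and contains exactly one
of `X_i ⊑ A_i`, `Y_i ⊑ A_i` for every `i`; the justifications for `A_n(x)` in `K_n` are
exactly the `2^n` sets `J_f`; each has cardinality `2n + 1`; and `A_n(x)` has exactly
`2^n` cardinality-minimal justifications in `K_n`. -/
theorem family_justifications_characterized (NC NR NI : Type) (n : ℕ) (hn : 1 ≤ n)
    (nm : Fin (n + 1) ⊕ (Fin n ⊕ Fin n) → NC) (hnm : Function.Injective nm) (x : NI) :
    (∀ J : Set (ELAxiom NC NR NI),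
      ELJustification (KBn NC NR NI n nm x)
        (ELAxiom.inst (ELConcept.atom (nm (Sum.inl (Fin.last n)))) x) J →
      (ELAxiom.inst (ELConcept.atom (nm (Sum.inl 0))) x ∈ J ∧
       (∀ i : Fin n, axGA NC NR NI n nm i ∈ J) ∧
       (∀ i : Fin n,
          (axGX NC NR NI n nm i ∈ J ∧ axGY NC NR NI n nm i ∉ J) ∨
          (axGX NC NR NI n nm i ∉ J ∧ axGY NC NR NI n nm i ∈ J)))) ∧
    {J : Set (ELAxiom NC NR NI) |
        ELJustification (KBn NC NR NI n nm x)
          (ELAxiom.inst (ELConcept.atom (nm (Sum.inl (Fin.last n)))) x) J} =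
      Set.range (Jfam NC NR NI n nm x) ∧
    (∀ f : Fin n → Bool, (Jfam NC NR NI n nm x f).ncard = 2 * n + 1) ∧
    {J : Set (ELAxiom NC NR NI) |
        ELJustification (KBn NC NR NI n nm x)
          (ELAxiom.inst (ELConcept.atom (nm (Sum.inl (Fin.last n)))) x) J ∧
        ∀ J₂ : Set (ELAxiom NC NR NI),
          ELJustification (KBn NC NR NI n nm x)
            (ELAxiom.inst (ELConcept.atom (nm (Sum.inl (Fin.last n)))) x) J₂ →
          J.ncard ≤ J₂.ncard}.ncard = 2 ^ n := by
  have hset := Set.ext (ELJustification_iff_mem_range_Jfam (NR := NR) (x := x) hnm)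
  refine ⟨fun J hJ => ?_, hset, ncard_Jfam hnm, ?_⟩
  · refine ⟨assertion_mem_of_entails hnm hJ.1 hJ.2.1, axGA_mem_of_entails hnm hJ.1 hJ.2.1,
      fun i => ?_⟩
    obtain ⟨f, rfl⟩ := (ELJustification_iff_mem_range_Jfam hnm J).1 hJ
    rw [axGX_mem_Jfam hnm, axGY_mem_Jfam hnm]
    cases f i <;> simp
  · have hmin : {J : Set (ELAxiom NC NR NI) |
        ELJustification (KBn NC NR NI n nm x)
          (ELAxiom.inst (ELConcept.atom (nm (Sum.inl (Fin.last n)))) x) J ∧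
        ∀ J₂ : Set (ELAxiom NC NR NI),
          ELJustification (KBn NC NR NI n nm x)
            (ELAxiom.inst (ELConcept.atom (nm (Sum.inl (Fin.last n)))) x) J₂ →
          J.ncard ≤ J₂.ncard} = Set.range (Jfam NC NR NI n nm x) := by
      ext J
      simp only [ELJustification_iff_mem_range_Jfam hnm, Set.mem_ofPred_eq, and_iff_left_iff_imp]
      rintro ⟨f, rfl⟩ _ ⟨g, rfl⟩
      rw [ncard_Jfam hnm, ncard_Jfam hnm]
    have hinj : Function.Injective (Jfam NC NR NI n nm x) := fun f g h =>
      eq_of_Jfam_subset hnm h.subset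
    rw [hmin, Set.ncard_range_of_injective hinj]
    simp
end
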